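/- Let H be a weak Hopf algebra over k with antipode S and let A be a right H-comodule algebra with coinvariant subalgebra B. Define k-linear maps β̃, β̃′ : A⊗_k A → A⊗H by β̃(a⊗a′) = a a′₍₀₎ ⊗ a′₍₁₎ and β̃′(a⊗a′) = a₍₀₎a′ ⊗ a₍₁₎, and η : A⊗H → A⊗H by η(a⊗h) = a₍₀₎ ⊗ a₍₁₎S(h). Then β̃′ = η∘β̃, the image of β̃′ is contained in ρ(1)(A⊗H), and the induced map β : A⊗_B A → (A⊗H)ρ(1) is injective (resp. surjective, bijective) if and only if the induced map β′ : A⊗_B A → ρ(1)(A⊗H), a⊗a′ ↦ a₍₀₎a′⊗a₍₁₎, is injective (resp. surjective onto ρ(1)(A⊗H), bijective). In particular, A|B is weak H-Galois if and only if β′ : A⊗_B A → ρ(1)(A⊗H) is bijective. -/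

import Mathlib

noncomputable section

open TensorProduct LinearMap

/-- A weak bialgebra over a field `k`: a finite-dimensional `k`-algebra with a `k`-coalgebra
structure whose comultiplication is multiplicative, with the weakened unit and counit axioms. -/
structure WeakBialgebra (k : Type*) [Field k] (H : Type*) [Ring H] [Algebra k H]
    [FiniteDimensional k H] where
  comul : H →ₗ[k] H ⊗[k] H
  counit : H →ₗ[k] k
  coassoc : ∀ x : H,
    (TensorProduct.assoc k H H H) ((rTensor H comul) (comul x)) = (lTensor H comul) (comul x)
  rTensor_counit_comul : ∀ x : H, (TensorProduct.lid k H) ((rTensor H counit) (comul x)) = x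
  lTensor_counit_comul : ∀ x : H, (TensorProduct.rid k H) ((lTensor H counit) (comul x)) = x
  comul_mul : ∀ a b : H, comul (a * b) = comul a * comul b
  -- `1₍₁₎ ⊗ 1₍₂₎ ⊗ 1₍₃₎ = (Δ(1) ⊗ 1)(1 ⊗ Δ(1)) = (1 ⊗ Δ(1))(Δ(1) ⊗ 1)`
  weak_one₁ : (lTensor H comul) (comul 1)
    = (TensorProduct.assoc k H H H) ((comul 1) ⊗ₜ[k] (1 : H)) * ((1 : H) ⊗ₜ[k] (comul 1))
  weak_one₂ : (lTensor H comul) (comul 1)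
    = ((1 : H) ⊗ₜ[k] (comul 1)) * (TensorProduct.assoc k H H H) ((comul 1) ⊗ₜ[k] (1 : H))
  -- `ε(abc) = ε(ab₍₁₎)ε(b₍₂₎c) = ε(ab₍₂₎)ε(b₍₁₎c)`
  weak_counit₁ : ∀ a b c : H, counit (a * b * c)
    = (LinearMap.mul' k k)
        ((TensorProduct.map (counit ∘ₗ mulLeft k a) (counit ∘ₗ mulRight k c)) (comul b))
  weak_counit₂ : ∀ a b c : H, counit (a * b * c)
    = (LinearMap.mul' k k)
        ((TensorProduct.map (counit ∘ₗ mulRight k c) (counit ∘ₗ mulLeft k a)) (comul b))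

namespace WeakBialgebra

variable {k : Type*} [Field k] {H : Type*} [Ring H] [Algebra k H] [FiniteDimensional k H]
variable (wb : WeakBialgebra k H)

/-- `ε ⊗ id : H ⊗ H → H`. -/
def εid : H ⊗[k] H →ₗ[k] H := (TensorProduct.lid k H).toLinearMap ∘ₗ rTensor H wb.counit

/-- `id ⊗ ε : H ⊗ H → H`. -/
def idε : H ⊗[k] H →ₗ[k] H := (TensorProduct.rid k H).toLinearMap ∘ₗ lTensor H wb.counit

/-- `Π^L(x) = ε(1₍₁₎x) 1₍₂₎`. -/
def projL : H →ₗ[k] H :=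
  wb.εid ∘ₗ mulLeft k (wb.comul 1) ∘ₗ (TensorProduct.mk k H H).flip 1

/-- `Π^R(x) = 1₍₁₎ ε(x1₍₂₎)`. -/
def projR : H →ₗ[k] H :=
  wb.idε ∘ₗ mulRight k (wb.comul 1) ∘ₗ TensorProduct.mk k H H 1

/-- `Π̄^L(x) = 1₍₁₎ ε(1₍₂₎x)`. -/
def projBarL : H →ₗ[k] H :=
  wb.idε ∘ₗ mulLeft k (wb.comul 1) ∘ₗ TensorProduct.mk k H H 1

/-- `Π̄^R(x) = ε(x1₍₁₎) 1₍₂₎`. -/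
def projBarR : H →ₗ[k] H :=
  wb.εid ∘ₗ mulRight k (wb.comul 1) ∘ₗ (TensorProduct.mk k H H).flip 1

/-- The antipode axioms for a weak Hopf algebra: `S(x₍₁₎)x₍₂₎ = Π^R(x)`,
`x₍₁₎S(x₍₂₎) = Π^L(x)` and `S(x₍₁₎)x₍₂₎S(x₍₃₎) = S(x)`. -/
structure IsAntipode (S : H →ₗ[k] H) : Prop where
  antipode_left : ∀ x : H, LinearMap.mul' k H ((rTensor H S) (wb.comul x)) = wb.projR x
  antipode_right : ∀ x : H, LinearMap.mul' k H ((lTensor H S) (wb.comul x)) = wb.projL x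
  antipode_mid : ∀ x : H,
    LinearMap.mul' k H
      ((TensorProduct.map (LinearMap.mul' k H ∘ₗ rTensor H S) S)
        ((rTensor H wb.comul) (wb.comul x))) = S x

end WeakBialgebra

/-- A right `H`-comodule algebra over a weak bialgebra `H`. -/
structure ComodAlg {k : Type*} [Field k] {H : Type*} [Ring H] [Algebra k H]
    [FiniteDimensional k H] (wb : WeakBialgebra k H)
    (A : Type*) [Ring A] [Algebra k A] where
  ρ : A →ₗ[k] A ⊗[k] H
  coassoc : ∀ a : A,
    (TensorProduct.assoc k A H H) ((rTensor H ρ) (ρ a)) = (lTensor A wb.comul) (ρ a)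
  counital : ∀ a : A, (TensorProduct.rid k A) ((lTensor A wb.counit) (ρ a)) = a
  mul : ∀ a b : A, ρ (a * b) = ρ a * ρ b
  piL : ∀ a : A, (lTensor A wb.projL) (ρ a) = ρ 1 * (a ⊗ₜ[k] (1 : H))
  pibarR : ∀ a : A, (lTensor A wb.projBarR) (ρ a) = (a ⊗ₜ[k] (1 : H)) * ρ 1

namespace ComodAlg

variable {k : Type*} [Field k] {H : Type*} [Ring H] [Algebra k H] [FiniteDimensional k H]
variable {wb : WeakBialgebra k H} {A : Type*} [Ring A] [Algebra k A]

/-- The coinvariant subalgebra `B = {b ∈ A : ρ(b) = 1₍₀₎b ⊗ 1₍₁₎}`. -/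
def coinv (ca : ComodAlg wb A) : Set A := {b | ca.ρ b = ca.ρ 1 * (b ⊗ₜ[k] (1 : H))}

/-- The `B`-balancing relations in `A ⊗_k A`, realizing `A ⊗_B A`. -/
def rel (ca : ComodAlg wb A) : Submodule k (A ⊗[k] A) :=
  Submodule.span k
    {z | ∃ a a' b : A, b ∈ ca.coinv ∧ z = (a * b) ⊗ₜ[k] a' - a ⊗ₜ[k] (b * a')}

/-- `A ⊗_B A`. -/
abbrev QA (ca : ComodAlg wb A) := (A ⊗[k] A) ⧸ ca.rel

/-- The canonical quotient map `A ⊗_k A → A ⊗_B A`. -/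
def mkA (ca : ComodAlg wb A) : A ⊗[k] A →ₗ[k] ca.QA := ca.rel.mkQ

end ComodAlg

section Convolution

variable {k C E : Type*} [Field k] [AddCommGroup C] [Module k C] [Ring E] [Algebra k E]

/-- The convolution product `x ↦ f(x₍₁₎) g(x₍₂₎)` with respect to a comultiplication `D`. -/
def convol (D : C →ₗ[k] C ⊗[k] C) (f g : C →ₗ[k] E) : C →ₗ[k] E :=
  LinearMap.mul' k E ∘ₗ TensorProduct.map f g ∘ₗ D

theorem convol_apply (D : C →ₗ[k] C ⊗[k] C) (f g : C →ₗ[k] E) (x : C) :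
    convol D f g x = LinearMap.mul' k E (TensorProduct.map f g (D x)) := rfl

theorem convol_assoc {D : C →ₗ[k] C ⊗[k] C}
    (hD : ∀ x, TensorProduct.assoc k C C C (rTensor C D (D x)) = lTensor C D (D x))
    (f g h : C →ₗ[k] E) : convol D (convol D f g) h = convol D f (convol D g h) := by
  have assoc_map : ∀ u : (C ⊗[k] C) ⊗[k] C,
      LinearMap.mul' k E (TensorProduct.map (LinearMap.mul' k E ∘ₗ TensorProduct.map f g) h u)
        = LinearMap.mul' k E (TensorProduct.map f (LinearMap.mul' k E ∘ₗ TensorProduct.map g h)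
            (TensorProduct.assoc k C C C u)) := by
    refine LinearMap.congr_fun (f := LinearMap.mul' k E ∘ₗ
      TensorProduct.map (LinearMap.mul' k E ∘ₗ TensorProduct.map f g) h)
      (g := LinearMap.mul' k E ∘ₗ TensorProduct.map f (LinearMap.mul' k E ∘ₗ
        TensorProduct.map g h) ∘ₗ (TensorProduct.assoc k C C C).toLinearMap) ?_
    ext a b c
    simp [mul_assoc]
  ext x
  have e := assoc_map (rTensor C D (D x))
  rw [hD, ← LinearMap.comp_apply (TensorProduct.map _ _), ← LinearMap.comp_apply
    (TensorProduct.map _ _), LinearMap.map_comp_rTensor, LinearMap.map_comp_lTensor] at e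
  exact e

theorem comp_convol {F : Type*} [Ring F] [Algebra k F] (D : C →ₗ[k] C ⊗[k] C)
    {p : E →ₗ[k] F} (hp : ∀ a b, p (a * b) = p a * p b) (f g : C →ₗ[k] E) :
    p ∘ₗ convol D f g = convol D (p ∘ₗ f) (p ∘ₗ g) := by
  have e : p ∘ₗ LinearMap.mul' k E ∘ₗ TensorProduct.map f g
      = LinearMap.mul' k F ∘ₗ TensorProduct.map (p ∘ₗ f) (p ∘ₗ g) := by
    ext a b
    simp [hp]
  ext x
  exact LinearMap.congr_fun e (D x)

end Convolution

section Assoc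

variable {k A B C : Type*} [Field k] [Ring A] [Algebra k A] [Ring B] [Algebra k B]
  [Ring C] [Algebra k C]

theorem assoc_mul (u v : (A ⊗[k] B) ⊗[k] C) :
    TensorProduct.assoc k A B C (u * v)
      = TensorProduct.assoc k A B C u * TensorProduct.assoc k A B C v :=
  map_mul (Algebra.TensorProduct.assoc k k k A B C) u v

end Assoc

namespace WeakBialgebra

variable {k : Type*} [Field k] {H : Type*} [Ring H] [Algebra k H] [FiniteDimensional k H]
variable (wb : WeakBialgebra k H)

/-- The left leg `φ(1₍₁₎) 1₍₂₎` of a functional `φ`. -/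
def legL (φ : H →ₗ[k] k) : H := TensorProduct.lid k H (rTensor H φ (wb.comul 1))

/-- The right leg `1₍₁₎ φ(1₍₂₎)` of a functional `φ`. -/
def legR (φ : H →ₗ[k] k) : H := TensorProduct.rid k H (lTensor H φ (wb.comul 1))

theorem projL_eq_legL (x : H) : wb.projL x = wb.legL (wb.counit ∘ₗ mulRight k x) := by
  have : ∀ s : H ⊗[k] H, wb.εid (s * (x ⊗ₜ 1))
      = TensorProduct.lid k H (rTensor H (wb.counit ∘ₗ mulRight k x) s) := by
    intro s
    induction s using TensorProduct.induction_on with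
    | zero => simp
    | add a b ha hb => simp only [add_mul, map_add, ha, hb]
    | tmul a b => simp [εid]
  exact this _

theorem projBarR_eq_legL (x : H) : wb.projBarR x = wb.legL (wb.counit ∘ₗ mulLeft k x) := by
  have : ∀ s : H ⊗[k] H, wb.εid ((x ⊗ₜ 1) * s)
      = TensorProduct.lid k H (rTensor H (wb.counit ∘ₗ mulLeft k x) s) := by
    intro s
    induction s using TensorProduct.induction_on with
    | zero => simp
    | add a b ha hb => simp only [mul_add, map_add, ha, hb]
    | tmul a b => simp [εid]
  exact this _

theorem projR_eq_legR (x : H) : wb.projR x = wb.legR (wb.counit ∘ₗ mulLeft k x) := by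
  have : ∀ s : H ⊗[k] H, wb.idε ((1 ⊗ₜ x) * s)
      = TensorProduct.rid k H (lTensor H (wb.counit ∘ₗ mulLeft k x) s) := by
    intro s
    induction s using TensorProduct.induction_on with
    | zero => simp
    | add a b ha hb => simp only [mul_add, map_add, ha, hb]
    | tmul a b => simp [idε]
  exact this _

theorem projBarL_eq_legR (x : H) : wb.projBarL x = wb.legR (wb.counit ∘ₗ mulRight k x) := by
  have : ∀ s : H ⊗[k] H, wb.idε (s * (1 ⊗ₜ x))
      = TensorProduct.rid k H (lTensor H (wb.counit ∘ₗ mulRight k x) s) := by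
    intro s
    induction s using TensorProduct.induction_on with
    | zero => simp
    | add a b ha hb => simp only [add_mul, map_add, ha, hb]
    | tmul a b => simp [idε]
  exact this _

theorem comul_one_mul (x : H) : wb.comul 1 * wb.comul x = wb.comul x := by
  rw [← wb.comul_mul, one_mul]

theorem comul_mul_one (x : H) : wb.comul x * wb.comul 1 = wb.comul x := by
  rw [← wb.comul_mul, mul_one]

theorem comul_legL (φ : H →ₗ[k] k) :
    wb.comul (wb.legL φ) = wb.comul 1 * (wb.legL φ ⊗ₜ 1) := by
  have h₁ : ∀ t : H ⊗[k] H, wb.comul (TensorProduct.lid k H (rTensor H φ t))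
      = TensorProduct.lid k _ (rTensor (H ⊗[k] H) φ (lTensor H wb.comul t)) := by
    intro t
    induction t using TensorProduct.induction_on with
    | zero => simp
    | add a b ha hb => simp only [map_add, ha, hb]
    | tmul a b => simp
  have h₂ : ∀ s t : H ⊗[k] H, TensorProduct.lid k _ (rTensor (H ⊗[k] H) φ
      ((1 ⊗ₜ s) * TensorProduct.assoc k H H H (t ⊗ₜ 1)))
        = s * (TensorProduct.lid k H (rTensor H φ t) ⊗ₜ 1) := by
    intro s t
    induction t using TensorProduct.induction_on with
    | zero => simp
    | add a b ha hb => simp only [map_add, TensorProduct.add_tmul, mul_add, ha, hb]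
    | tmul a b => simp [← TensorProduct.smul_tmul']
  rw [legL, h₁, wb.weak_one₂, h₂]

theorem comul_legR (φ : H →ₗ[k] k) :
    wb.comul (wb.legR φ) = (1 ⊗ₜ wb.legR φ) * wb.comul 1 := by
  have h₁ : ∀ t : H ⊗[k] H, wb.comul (TensorProduct.rid k H (lTensor H φ t))
      = lTensor H ((TensorProduct.rid k H).toLinearMap ∘ₗ lTensor H φ)
          (TensorProduct.assoc k H H H (rTensor H wb.comul t)) := by
    intro t
    induction t using TensorProduct.induction_on with
    | zero => simp
    | add a b ha hb => simp only [map_add, ha, hb]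
    | tmul a b =>
      simp only [lTensor_tmul, rTensor_tmul, TensorProduct.rid_tmul, map_smul]
      induction wb.comul a using TensorProduct.induction_on with
      | zero => simp
      | add c d hc hd => simp only [map_add, TensorProduct.add_tmul, smul_add, hc, hd]
      | tmul c d => simp
  have h₂ : ∀ s t : H ⊗[k] H,
      lTensor H ((TensorProduct.rid k H).toLinearMap ∘ₗ lTensor H φ)
        ((1 ⊗ₜ s) * TensorProduct.assoc k H H H (t ⊗ₜ 1))
        = (1 ⊗ₜ TensorProduct.rid k H (lTensor H φ s)) * t := by
    intro s t
    induction t using TensorProduct.induction_on with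
    | zero => simp
    | add a b ha hb => simp only [map_add, TensorProduct.add_tmul, mul_add, ha, hb]
    | tmul a b =>
      induction s using TensorProduct.induction_on with
      | zero => simp
      | add c d hc hd => simp only [map_add, TensorProduct.tmul_add, add_mul, hc, hd]
      | tmul c d => simp
  rw [legR, h₁, wb.coassoc, wb.weak_one₂, h₂]

theorem legL_mul_legR (φ ψ : H →ₗ[k] k) :
    wb.legL φ * wb.legR ψ = wb.legR ψ * wb.legL φ := by
  have h₁ : ∀ s t : H ⊗[k] H, TensorProduct.lid k _ (rTensor H φ
      (lTensor H ((TensorProduct.rid k H).toLinearMap ∘ₗ lTensor H ψ)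
        (TensorProduct.assoc k H H H (t ⊗ₜ 1) * (1 ⊗ₜ s))))
      = TensorProduct.lid k H (rTensor H φ t) * TensorProduct.rid k H (lTensor H ψ s) := by
    intro s t
    induction t using TensorProduct.induction_on with
    | zero => simp
    | add a b ha hb => simp only [map_add, TensorProduct.add_tmul, add_mul, ha, hb]
    | tmul a b =>
      induction s using TensorProduct.induction_on with
      | zero => simp
      | add c d hc hd => simp only [map_add, TensorProduct.tmul_add, mul_add, hc, hd]
      | tmul c d => simp
  have h₂ : ∀ s t : H ⊗[k] H, TensorProduct.lid k _ (rTensor H φ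
      (lTensor H ((TensorProduct.rid k H).toLinearMap ∘ₗ lTensor H ψ)
        ((1 ⊗ₜ s) * TensorProduct.assoc k H H H (t ⊗ₜ 1))))
      = TensorProduct.rid k H (lTensor H ψ s) * TensorProduct.lid k H (rTensor H φ t) := by
    intro s t
    induction t using TensorProduct.induction_on with
    | zero => simp
    | add a b ha hb => simp only [map_add, TensorProduct.add_tmul, mul_add, ha, hb]
    | tmul a b =>
      induction s using TensorProduct.induction_on with
      | zero => simp
      | add c d hc hd => simp only [map_add, TensorProduct.tmul_add, add_mul, hc, hd]
      | tmul c d => simp [smul_comm (φ a)]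
  rw [legL, legR, ← h₁, ← h₂, ← wb.weak_one₁, ← wb.weak_one₂]

theorem counit_projL_right (d x : H) : wb.counit (d * wb.projL x) = wb.counit (d * x) := by
  have : ∀ t : H ⊗[k] H,
      wb.counit (d * TensorProduct.lid k H (rTensor H (wb.counit ∘ₗ mulRight k x) t))
        = LinearMap.mul' k k (TensorProduct.map (wb.counit ∘ₗ mulRight k x)
            (wb.counit ∘ₗ mulLeft k d) t) := by
    intro t
    induction t using TensorProduct.induction_on with
    | zero => simp
    | add a b ha hb => simp only [map_add, mul_add, ha, hb]
    | tmul a b => simp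
  rw [projL_eq_legL, legL, this, ← wb.weak_counit₂, mul_one]

theorem counit_projBarL_right (d x : H) : wb.counit (d * wb.projBarL x) = wb.counit (d * x) := by
  have : ∀ t : H ⊗[k] H,
      wb.counit (d * TensorProduct.rid k H (lTensor H (wb.counit ∘ₗ mulRight k x) t))
        = LinearMap.mul' k k (TensorProduct.map (wb.counit ∘ₗ mulLeft k d)
            (wb.counit ∘ₗ mulRight k x) t) := by
    intro t
    induction t using TensorProduct.induction_on with
    | zero => simp
    | add a b ha hb => simp only [map_add, mul_add, ha, hb]
    | tmul a b => simp [mul_comm]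
  rw [projBarL_eq_legR, legR, this, ← wb.weak_counit₁, mul_one]

theorem counit_projR_left (x d : H) : wb.counit (wb.projR x * d) = wb.counit (x * d) := by
  have : ∀ t : H ⊗[k] H,
      wb.counit (TensorProduct.rid k H (lTensor H (wb.counit ∘ₗ mulLeft k x) t) * d)
        = LinearMap.mul' k k (TensorProduct.map (wb.counit ∘ₗ mulRight k d)
            (wb.counit ∘ₗ mulLeft k x) t) := by
    intro t
    induction t using TensorProduct.induction_on with
    | zero => simp
    | add a b ha hb => simp only [map_add, add_mul, ha, hb]
    | tmul a b => simp [mul_comm]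
  rw [projR_eq_legR, legR, this, ← wb.weak_counit₂, mul_one]

theorem counit_projBarR_left (x d : H) : wb.counit (wb.projBarR x * d) = wb.counit (x * d) := by
  have : ∀ t : H ⊗[k] H,
      wb.counit (TensorProduct.lid k H (rTensor H (wb.counit ∘ₗ mulLeft k x) t) * d)
        = LinearMap.mul' k k (TensorProduct.map (wb.counit ∘ₗ mulLeft k x)
            (wb.counit ∘ₗ mulRight k d) t) := by
    intro t
    induction t using TensorProduct.induction_on with
    | zero => simp
    | add a b ha hb => simp only [map_add, add_mul, ha, hb]
    | tmul a b => simp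
  rw [projBarR_eq_legL, legL, this, ← wb.weak_counit₁, mul_one]

theorem projL_mul_projL (x y : H) : wb.projL (x * wb.projL y) = wb.projL (x * y) := by
  rw [wb.projL_eq_legL (x * wb.projL y), wb.projL_eq_legL (x * y)]
  refine congrArg wb.legL (LinearMap.ext fun d => ?_)
  simp [counit_projL_right]

theorem projL_projBarL (x : H) : wb.projL (wb.projBarL x) = wb.projL x := by
  rw [projL_eq_legL, projL_eq_legL]
  refine congrArg wb.legL (LinearMap.ext fun d => ?_)
  simp [counit_projBarL_right]

theorem projR_projR_mul (x y : H) : wb.projR (wb.projR x * y) = wb.projR (x * y) := by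
  rw [wb.projR_eq_legR (wb.projR x * y), wb.projR_eq_legR (x * y)]
  refine congrArg wb.legR (LinearMap.ext fun d => ?_)
  simp [counit_projR_left]

theorem projR_projBarR (x : H) : wb.projR (wb.projBarR x) = wb.projR x := by
  rw [projR_eq_legR, projR_eq_legR]
  refine congrArg wb.legR (LinearMap.ext fun d => ?_)
  simp [counit_projBarR_left]

theorem convol_projL_id : convol wb.comul wb.projL LinearMap.id = LinearMap.id := by
  have : ∀ s t : H ⊗[k] H, LinearMap.mul' k H (TensorProduct.map
      (wb.εid ∘ₗ mulLeft k s ∘ₗ (TensorProduct.mk k H H).flip 1) LinearMap.id t)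
        = wb.εid (s * t) := by
    intro s t
    induction t using TensorProduct.induction_on with
    | zero => simp
    | add a b ha hb => simp only [map_add, mul_add, ha, hb]
    | tmul a b =>
      induction s using TensorProduct.induction_on with
      | zero => simp
      | add c d hc hd =>
        simp only [TensorProduct.map_tmul, LinearMap.comp_apply, mulLeft_apply, add_mul,
          map_add, LinearMap.mul'_apply] at hc hd ⊢
        rw [hc, hd]
      | tmul c d => simp [εid]
  ext x
  refine (this _ _).trans ?_
  rw [comul_one_mul]
  exact wb.rTensor_counit_comul x

theorem convol_id_projR : convol wb.comul LinearMap.id wb.projR = LinearMap.id := by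
  have : ∀ s t : H ⊗[k] H, LinearMap.mul' k H (TensorProduct.map LinearMap.id
      (wb.idε ∘ₗ mulRight k s ∘ₗ TensorProduct.mk k H H 1) t)
        = wb.idε (t * s) := by
    intro s t
    induction t using TensorProduct.induction_on with
    | zero => simp
    | add a b ha hb => simp only [map_add, add_mul, ha, hb]
    | tmul a b =>
      induction s using TensorProduct.induction_on with
      | zero => simp
      | add c d hc hd =>
        simp only [TensorProduct.map_tmul, LinearMap.comp_apply, mulRight_apply, mul_add,
          map_add, LinearMap.mul'_apply] at hc hd ⊢
        rw [hc, hd]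
      | tmul c d => simp [idε]
  ext x
  refine (this _ _).trans ?_
  rw [comul_mul_one]
  exact wb.lTensor_counit_comul x

theorem lTensor_projL_comul (x : H) :
    lTensor H wb.projL (wb.comul x) = wb.comul 1 * (x ⊗ₜ 1) := by
  have h₁ : ∀ s t : H ⊗[k] H,
      lTensor H (wb.εid ∘ₗ mulLeft k s ∘ₗ (TensorProduct.mk k H H).flip 1) t
        = lTensor H wb.εid ((1 ⊗ₜ s) * TensorProduct.assoc k H H H (t ⊗ₜ 1)) := by
    intro s t
    induction t using TensorProduct.induction_on with
    | zero => simp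
    | add a b ha hb => simp only [map_add, TensorProduct.add_tmul, mul_add, ha, hb]
    | tmul a b => simp
  have h₂ : ∀ (t : H ⊗[k] H) (d : H),
      lTensor H wb.εid (TensorProduct.assoc k H H H (t ⊗ₜ d))
        = TensorProduct.rid k H (lTensor H wb.counit t) ⊗ₜ d := by
    intro t d
    induction t using TensorProduct.induction_on with
    | zero => simp
    | add a b ha hb => simp only [map_add, TensorProduct.add_tmul, ha, hb]
    | tmul a b => simp [εid, ← TensorProduct.smul_tmul']
  have h₃ : ∀ s : H ⊗[k] H, lTensor H wb.εid (TensorProduct.assoc k H H H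
      (rTensor H wb.comul s) * TensorProduct.assoc k H H H (wb.comul x ⊗ₜ 1))
        = s * (x ⊗ₜ 1) := by
    intro s
    induction s using TensorProduct.induction_on with
    | zero => simp
    | add a b ha hb => simp only [map_add, add_mul, ha, hb]
    | tmul a b =>
      rw [← assoc_mul, rTensor_tmul, Algebra.TensorProduct.tmul_mul_tmul, ← wb.comul_mul, h₂,
        wb.lTensor_counit_comul, Algebra.TensorProduct.tmul_mul_tmul]
  have h₄ : wb.comul x ⊗ₜ[k] (1 : H) = (wb.comul 1 ⊗ₜ 1) * (wb.comul x ⊗ₜ 1) := by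
    rw [Algebra.TensorProduct.tmul_mul_tmul, comul_one_mul, mul_one]
  refine (h₁ _ _).trans ?_
  rw [h₄, assoc_mul, ← mul_assoc, ← wb.weak_one₂, ← wb.coassoc, h₃]

theorem rTensor_projR_comul (x : H) :
    rTensor H wb.projR (wb.comul x) = (1 ⊗ₜ x) * wb.comul 1 := by
  have h₁ : ∀ s t : H ⊗[k] H,
      rTensor H (wb.idε ∘ₗ mulRight k s ∘ₗ TensorProduct.mk k H H 1) t
        = lTensor H wb.εid ((1 ⊗ₜ t) * TensorProduct.assoc k H H H (s ⊗ₜ 1)) := by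
    intro s t
    induction t using TensorProduct.induction_on with
    | zero => simp
    | add a b ha hb => simp only [map_add, TensorProduct.tmul_add, add_mul, ha, hb]
    | tmul a b =>
      induction s using TensorProduct.induction_on with
      | zero => simp
      | add c d hc hd =>
        simp only [rTensor_tmul, LinearMap.comp_apply, mulRight_apply, mul_add,
          map_add, TensorProduct.add_tmul] at hc hd ⊢
        rw [hc, hd]
      | tmul c d => simp [idε, εid, TensorProduct.smul_tmul]
  have h₂ : ∀ s : H ⊗[k] H,
      lTensor H wb.εid ((1 ⊗ₜ wb.comul x) * lTensor H wb.comul s) = (1 ⊗ₜ x) * s := by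
    intro s
    induction s using TensorProduct.induction_on with
    | zero => simp
    | add a b ha hb => simp only [map_add, mul_add, ha, hb]
    | tmul a b =>
      rw [lTensor_tmul, Algebra.TensorProduct.tmul_mul_tmul, ← wb.comul_mul, lTensor_tmul,
        Algebra.TensorProduct.tmul_mul_tmul]
      congr 1
      exact wb.rTensor_counit_comul _
  have h₃ : (1 : H) ⊗ₜ[k] wb.comul x = (1 ⊗ₜ wb.comul x) * (1 ⊗ₜ wb.comul 1) := by
    rw [Algebra.TensorProduct.tmul_mul_tmul, comul_mul_one, mul_one]
  refine (h₁ _ _).trans ?_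
  rw [h₃, mul_assoc, ← wb.weak_one₂, h₂]

end WeakBialgebra

section Antipode

namespace WeakBialgebra

variable {k : Type*} [Field k] {H : Type*} [Ring H] [Algebra k H] [FiniteDimensional k H]
variable {wb : WeakBialgebra k H} {S : H →ₗ[k] H}

namespace IsAntipode

theorem convol_left (hS : wb.IsAntipode S) : convol wb.comul S LinearMap.id = wb.projR :=
  LinearMap.ext hS.antipode_left

theorem convol_right (hS : wb.IsAntipode S) : convol wb.comul LinearMap.id S = wb.projL :=
  LinearMap.ext hS.antipode_right

theorem convol_projR (hS : wb.IsAntipode S) : convol wb.comul wb.projR S = S := by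
  rw [← hS.convol_left]
  ext x
  refine Eq.trans ?_ (hS.antipode_mid x)
  rw [← LinearMap.comp_apply (TensorProduct.map _ _), LinearMap.map_comp_rTensor]
  rfl

theorem convol_projL (hS : wb.IsAntipode S) : convol wb.comul S wb.projL = S := by
  rw [← hS.convol_right, ← convol_assoc wb.coassoc, hS.convol_left, hS.convol_projR]

theorem apply_eq_projR (hS : wb.IsAntipode S) {z : H}
    (hz : wb.comul z = wb.comul 1 * (z ⊗ₜ 1)) : S z = wb.projR z := by
  rw [← hS.antipode_left, ← LinearMap.congr_fun hS.convol_projL z, convol_apply,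
    ← LinearMap.rTensor_comp_lTensor, LinearMap.comp_apply, wb.lTensor_projL_comul, ← hz]

theorem apply_eq_projL (hS : wb.IsAntipode S) {w : H}
    (hw : wb.comul w = (1 ⊗ₜ w) * wb.comul 1) : S w = wb.projL w := by
  rw [← hS.antipode_right, ← LinearMap.congr_fun hS.convol_projR w, convol_apply,
    ← LinearMap.lTensor_comp_rTensor, LinearMap.comp_apply, wb.rTensor_projR_comul, ← hw]

theorem comp_projBarR (hS : wb.IsAntipode S) : S ∘ₗ wb.projBarR = wb.projR := by
  ext x
  rw [LinearMap.comp_apply, hS.apply_eq_projR, wb.projR_projBarR]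
  rw [projBarR_eq_legL, comul_legL]

theorem comp_projBarL (hS : wb.IsAntipode S) : S ∘ₗ wb.projBarL = wb.projL := by
  ext x
  rw [LinearMap.comp_apply, hS.apply_eq_projL, wb.projL_projBarL]
  rw [projBarL_eq_legR, comul_legR]

/-- Multiplicative maps are determined by their values on the image of the antipode. -/
theorem eq_of_comp_eq (hS : wb.IsAntipode S) {E : Type*} [Ring E] [Algebra k E]
    {f g : H →ₗ[k] E} (hf : ∀ a b, f (a * b) = f a * f b) (hg : ∀ a b, g (a * b) = g a * g b)
    (h : f ∘ₗ S = g ∘ₗ S) : f = g := by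
  have hL : f ∘ₗ wb.projL = g ∘ₗ wb.projL := by
    rw [← hS.comp_projBarL, ← LinearMap.comp_assoc, h, LinearMap.comp_assoc]
  have hR : f ∘ₗ wb.projR = g ∘ₗ wb.projR := by
    rw [← hS.comp_projBarR, ← LinearMap.comp_assoc, h, LinearMap.comp_assoc]
  calc f = f ∘ₗ convol wb.comul wb.projL LinearMap.id := by
        rw [wb.convol_projL_id, LinearMap.comp_id]
    _ = convol wb.comul (convol wb.comul g (g ∘ₗ S)) f := by
        rw [comp_convol _ hf, hL, ← hS.convol_right, comp_convol _ hg]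
        rfl
    _ = convol wb.comul g (convol wb.comul (f ∘ₗ S) f) := by
        rw [convol_assoc wb.coassoc, h]
    _ = g ∘ₗ convol wb.comul LinearMap.id wb.projR := by
        rw [comp_convol _ hg, ← hR, ← hS.convol_left, comp_convol _ hf]
        rfl
    _ = g := by rw [wb.convol_id_projR, LinearMap.comp_id]

end IsAntipode

/-- A weak bialgebra is in particular a coalgebra. -/
abbrev toCoalgebra (wb : WeakBialgebra k H) : Coalgebra k H where
  comul := wb.comul
  counit := wb.counit
  coassoc := LinearMap.ext wb.coassoc
  rTensor_counit_comp_comul := by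
    ext x
    apply (TensorProduct.lid k H).injective
    simpa using wb.rTensor_counit_comul x
  lTensor_counit_comp_comul := by
    ext x
    apply (TensorProduct.rid k H).injective
    simpa using wb.lTensor_counit_comul x

/-- The comultiplication of `H ⊗ H`. -/
def comulTensor (wb : WeakBialgebra k H) :
    H ⊗[k] H →ₗ[k] (H ⊗[k] H) ⊗[k] (H ⊗[k] H) :=
  (TensorProduct.tensorTensorTensorComm k H H H H).toLinearMap ∘ₗ
    TensorProduct.map wb.comul wb.comul

theorem comulTensor_coassoc (wb : WeakBialgebra k H) (x : H ⊗[k] H) :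
    TensorProduct.assoc k _ _ _ (rTensor _ wb.comulTensor (wb.comulTensor x))
      = lTensor _ wb.comulTensor (wb.comulTensor x) := by
  let := wb.toCoalgebra
  exact Coalgebra.coassoc_apply (R := k) x

theorem convol_comulTensor_mul {E : Type*} [Ring E] [Algebra k E] (f g : H →ₗ[k] E) :
    convol wb.comulTensor (f ∘ₗ LinearMap.mul' k H) (g ∘ₗ LinearMap.mul' k H)
      = convol wb.comul f g ∘ₗ LinearMap.mul' k H := by
  have : ∀ s t : H ⊗[k] H, TensorProduct.map (f ∘ₗ LinearMap.mul' k H) (g ∘ₗ LinearMap.mul' k H)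
      (TensorProduct.tensorTensorTensorComm k H H H H (s ⊗ₜ t))
        = TensorProduct.map f g (s * t) := by
    intro s t
    induction s using TensorProduct.induction_on with
    | zero => simp
    | add a b ha hb => simp only [map_add, TensorProduct.add_tmul, add_mul, ha, hb]
    | tmul a b =>
      induction t using TensorProduct.induction_on with
      | zero => simp
      | add c d hc hd => simp only [map_add, TensorProduct.tmul_add, mul_add, hc, hd]
      | tmul c d => simp
  ext x y
  simp only [TensorProduct.AlgebraTensorModule.curry_apply, TensorProduct.curry_apply,
    LinearMap.coe_restrictScalars, LinearMap.comp_apply, convol_apply, comulTensor,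
    TensorProduct.map_tmul, LinearEquiv.coe_coe, this, LinearMap.mul'_apply, wb.comul_mul]

namespace IsAntipode

theorem convol_opMul_mul (hS : wb.IsAntipode S) :
    convol wb.comulTensor (LinearMap.mul' k H ∘ₗ TensorProduct.map S S ∘ₗ
      (TensorProduct.comm k H H).toLinearMap) (LinearMap.mul' k H)
      = wb.projR ∘ₗ LinearMap.mul' k H := by
  have key : ∀ s t : H ⊗[k] H, LinearMap.mul' k H (TensorProduct.map (LinearMap.mul' k H ∘ₗ
      TensorProduct.map S S ∘ₗ (TensorProduct.comm k H H).toLinearMap) (LinearMap.mul' k H)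
      (TensorProduct.tensorTensorTensorComm k H H H H (s ⊗ₜ t)))
        = LinearMap.mul' k H (rTensor H S ((1 ⊗ₜ LinearMap.mul' k H (rTensor H S s)) * t)) := by
    intro s t
    induction s using TensorProduct.induction_on with
    | zero => simp
    | add a b ha hb =>
      simp only [map_add, TensorProduct.add_tmul, TensorProduct.tmul_add, add_mul, ha, hb]
    | tmul a b =>
      induction t using TensorProduct.induction_on with
      | zero => simp
      | add c d hc hd => simp only [map_add, TensorProduct.tmul_add, mul_add, hc, hd]
      | tmul c d => simp [mul_assoc]
  have hw : ∀ x y : H, (1 ⊗ₜ wb.projR x) * wb.comul y = wb.comul (wb.projR x * y) := by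
    intro x y
    rw [wb.comul_mul, projR_eq_legR, comul_legR, mul_assoc, comul_one_mul]
  ext x y
  refine (key _ _).trans ?_
  rw [hS.antipode_left, hw, hS.antipode_left, projR_projR_mul]
  rfl

theorem convol_mul_opMul (hS : wb.IsAntipode S) :
    convol wb.comulTensor (LinearMap.mul' k H) (LinearMap.mul' k H ∘ₗ TensorProduct.map S S ∘ₗ
      (TensorProduct.comm k H H).toLinearMap)
      = wb.projL ∘ₗ LinearMap.mul' k H := by
  have key : ∀ s t : H ⊗[k] H, LinearMap.mul' k H (TensorProduct.map (LinearMap.mul' k H)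
      (LinearMap.mul' k H ∘ₗ TensorProduct.map S S ∘ₗ (TensorProduct.comm k H H).toLinearMap)
      (TensorProduct.tensorTensorTensorComm k H H H H (s ⊗ₜ t)))
        = LinearMap.mul' k H (lTensor H S (s * (LinearMap.mul' k H (lTensor H S t) ⊗ₜ 1))) := by
    intro s t
    induction s using TensorProduct.induction_on with
    | zero => simp
    | add a b ha hb => simp only [map_add, TensorProduct.add_tmul, add_mul, ha, hb]
    | tmul a b =>
      induction t using TensorProduct.induction_on with
      | zero => simp
      | add c d hc hd =>
        simp only [map_add, TensorProduct.tmul_add, TensorProduct.add_tmul, mul_add, hc, hd]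
      | tmul c d => simp [mul_assoc]
  have hz : ∀ x y : H, wb.comul x * (wb.projL y ⊗ₜ 1) = wb.comul (x * wb.projL y) := by
    intro x y
    rw [wb.comul_mul, projL_eq_legL, comul_legL, ← mul_assoc, comul_mul_one]
  ext x y
  refine (key _ _).trans ?_
  rw [hS.antipode_right, hz, hS.antipode_right, projL_mul_projL]
  rfl

theorem convol_projL_mulRight (hS : wb.IsAntipode S) (x y : H) :
    convol wb.comul S (wb.projL ∘ₗ mulRight k y) x = wb.projL y * S x := by
  have e₁ : wb.projL ∘ₗ mulRight k y = convol wb.comul (mulRight k (wb.projL y)) S := by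
    ext a
    have key : ∀ (s : H ⊗[k] H) (z : H), LinearMap.mul' k H (lTensor H S (s * (z ⊗ₜ 1)))
        = LinearMap.mul' k H (TensorProduct.map (mulRight k z) S s) := by
      intro s z
      induction s using TensorProduct.induction_on with
      | zero => simp
      | add a b ha hb => simp only [map_add, add_mul, ha, hb]
      | tmul a b => simp
    rw [convol_apply, ← key, LinearMap.comp_apply, mulRight_apply, ← projL_mul_projL,
      ← hS.antipode_right, wb.comul_mul, projL_eq_legL, comul_legL, ← mul_assoc, comul_mul_one]
  have e₂ : convol wb.comul S (mulRight k (wb.projL y)) = mulLeft k (wb.projL y) ∘ₗ wb.projR := by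
    have key : ∀ (s : H ⊗[k] H) (z : H), LinearMap.mul' k H (TensorProduct.map S (mulRight k z) s)
        = LinearMap.mul' k H (rTensor H S s) * z := by
      intro s z
      induction s using TensorProduct.induction_on with
      | zero => simp
      | add a b ha hb => simp only [map_add, add_mul, ha, hb]
      | tmul a b => simp [mul_assoc]
    ext a
    rw [convol_apply, key, hS.antipode_left, LinearMap.comp_apply, mulLeft_apply,
      projL_eq_legL, projR_eq_legR, legL_mul_legR]
  have e₃ : ∀ (s : H ⊗[k] H) (z : H),
      LinearMap.mul' k H (TensorProduct.map (mulLeft k z ∘ₗ wb.projR) S s)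
        = z * LinearMap.mul' k H (TensorProduct.map wb.projR S s) := by
    intro s z
    induction s using TensorProduct.induction_on with
    | zero => simp
    | add a b ha hb => simp only [map_add, mul_add, ha, hb]
    | tmul a b => simp [mul_assoc]
  rw [e₁, ← convol_assoc wb.coassoc, e₂, convol_apply, e₃, ← convol_apply, hS.convol_projR]

theorem convol_opMul_projL (hS : wb.IsAntipode S) :
    convol wb.comulTensor (LinearMap.mul' k H ∘ₗ TensorProduct.map S S ∘ₗ
      (TensorProduct.comm k H H).toLinearMap) (wb.projL ∘ₗ LinearMap.mul' k H)
      = LinearMap.mul' k H ∘ₗ TensorProduct.map S S ∘ₗ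
        (TensorProduct.comm k H H).toLinearMap := by
  have h₁ : ∀ (s : H ⊗[k] H) (c d : H), LinearMap.mul' k H (TensorProduct.map
      (LinearMap.mul' k H ∘ₗ TensorProduct.map S S ∘ₗ (TensorProduct.comm k H H).toLinearMap)
      (wb.projL ∘ₗ LinearMap.mul' k H)
      (TensorProduct.tensorTensorTensorComm k H H H H (s ⊗ₜ (c ⊗ₜ d))))
        = S c * LinearMap.mul' k H (TensorProduct.map S (wb.projL ∘ₗ mulRight k d) s) := by
    intro s c d
    induction s using TensorProduct.induction_on with
    | zero => simp
    | add a b ha hb => simp only [map_add, TensorProduct.add_tmul, mul_add, ha, hb]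
    | tmul a b => simp [mul_assoc]
  have h₂ : ∀ (x : H) (t : H ⊗[k] H), LinearMap.mul' k H (TensorProduct.map
      (LinearMap.mul' k H ∘ₗ TensorProduct.map S S ∘ₗ (TensorProduct.comm k H H).toLinearMap)
      (wb.projL ∘ₗ LinearMap.mul' k H)
      (TensorProduct.tensorTensorTensorComm k H H H H (wb.comul x ⊗ₜ t)))
        = LinearMap.mul' k H (TensorProduct.map S wb.projL t) * S x := by
    intro x t
    induction t using TensorProduct.induction_on with
    | zero => simp
    | add a b ha hb => simp only [map_add, TensorProduct.tmul_add, add_mul, ha, hb]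
    | tmul c d =>
      rw [h₁, ← convol_apply, hS.convol_projL_mulRight, TensorProduct.map_tmul,
        LinearMap.mul'_apply, mul_assoc]
  ext x y
  refine (h₂ _ _).trans ?_
  rw [← convol_apply, hS.convol_projL]
  rfl

/-- The antipode is antimultiplicative. -/
theorem map_mul (hS : wb.IsAntipode S) (x y : H) : S (x * y) = S y * S x := by
  set G : H ⊗[k] H →ₗ[k] H := LinearMap.mul' k H ∘ₗ TensorProduct.map S S ∘ₗ
    (TensorProduct.comm k H H).toLinearMap
  have hF : convol wb.comulTensor (S ∘ₗ LinearMap.mul' k H) (LinearMap.mul' k H)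
      = wb.projR ∘ₗ LinearMap.mul' k H := by
    rw [← hS.convol_left, ← convol_comulTensor_mul, LinearMap.id_comp]
  have : S ∘ₗ LinearMap.mul' k H = G := calc
    _ = convol wb.comulTensor (S ∘ₗ LinearMap.mul' k H) (wb.projL ∘ₗ LinearMap.mul' k H) := by
        rw [convol_comulTensor_mul, hS.convol_projL]
    _ = convol wb.comulTensor G (wb.projL ∘ₗ LinearMap.mul' k H) := by
        rw [← hS.convol_mul_opMul, ← convol_assoc wb.comulTensor_coassoc,
          ← convol_assoc wb.comulTensor_coassoc, hF, hS.convol_opMul_mul]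
    _ = G := hS.convol_opMul_projL
  exact LinearMap.congr_fun this (x ⊗ₜ y)

theorem eq_of_comp_sq_eq (hS : wb.IsAntipode S) {E : Type*} [Ring E] [Algebra k E]
    {f g : H →ₗ[k] E} (hf : ∀ a b, f (a * b) = f a * f b) (hg : ∀ a b, g (a * b) = g a * g b)
    (h : f ∘ₗ (S ∘ₗ S) = g ∘ₗ (S ∘ₗ S)) : f = g := by
  refine hS.eq_of_comp_eq hf hg ?_
  have : (MulOpposite.opLinearEquiv k).toLinearMap ∘ₗ f ∘ₗ S
      = (MulOpposite.opLinearEquiv k).toLinearMap ∘ₗ g ∘ₗ S := by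
    refine hS.eq_of_comp_eq (fun a b => ?_) (fun a b => ?_) ?_
    · simp [hS.map_mul, hf]
    · simp [hS.map_mul, hg]
    · rw [LinearMap.comp_assoc, LinearMap.comp_assoc, LinearMap.comp_assoc, LinearMap.comp_assoc, h]
  ext x
  exact MulOpposite.op_injective (LinearMap.congr_fun this x)

theorem comp_self_pow_map_mul (hS : wb.IsAntipode S) (m : ℕ) (a b : H) :
    ((S ∘ₗ S : Module.End k H) ^ m) (a * b)
      = ((S ∘ₗ S : Module.End k H) ^ m) a * ((S ∘ₗ S : Module.End k H) ^ m) b := by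
  induction m generalizing a b with
  | zero => simp
  | succ m ih => simp [pow_succ, hS.map_mul, ih]

theorem eq_of_comp_pow_eq (hS : wb.IsAntipode S) {f g : H →ₗ[k] H}
    (hf : ∀ a b, f (a * b) = f a * f b) (hg : ∀ a b, g (a * b) = g a * g b) (n : ℕ)
    (h : f ∘ₗ ((S ∘ₗ S : Module.End k H) ^ n : Module.End k H)
      = g ∘ₗ ((S ∘ₗ S : Module.End k H) ^ n : Module.End k H)) : f = g := by
  induction n with
  | zero => exact h
  | succ n ih =>
    refine ih (hS.eq_of_comp_sq_eq (fun a b => ?_) (fun a b => ?_) ?_)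
    · simp [hS.comp_self_pow_map_mul, hf]
    · simp [hS.comp_self_pow_map_mul, hg]
    · rw [pow_succ] at h
      exact h

/-- The antipode of a (finite-dimensional) weak Hopf algebra is injective. -/
theorem injective (hS : wb.IsAntipode S) : Function.Injective S := by
  let φ : Module.End k H := S ∘ₗ S
  have hφ : ∀ (m : ℕ) (a b : H), (φ ^ m) (a * b) = (φ ^ m) a * (φ ^ m) b :=
    hS.comp_self_pow_map_mul
  obtain ⟨n, hn⟩ := Filter.eventually_atTop.mp φ.eventually_isCompl_ker_pow_range_pow
  have hc := (hn (n + 1) (Nat.le_succ n)).symm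
  let g := (LinearMap.range (φ ^ (n + 1))).projection _ hc
  have hg_mem : ∀ x, g x ∈ LinearMap.range (φ ^ (n + 1)) := Submodule.projection_apply_mem hc
  have hg_sub : ∀ x, (φ ^ (n + 1)) (g x) = (φ ^ (n + 1)) x := by
    intro x
    have := Submodule.sub_projection_mem hc x
    rw [LinearMap.mem_ker, map_sub, sub_eq_zero] at this
    exact this.symm
  have hg_unique : ∀ c x, c ∈ LinearMap.range (φ ^ (n + 1)) →
      (φ ^ (n + 1)) c = (φ ^ (n + 1)) x → c = g x := by
    intro c x hcm hcx
    have : c - g x ∈ LinearMap.range (φ ^ (n + 1)) ⊓ LinearMap.ker (φ ^ (n + 1)) :=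
      ⟨sub_mem hcm (hg_mem x), LinearMap.mem_ker.mpr (by rw [map_sub, hcx, hg_sub, sub_self])⟩
    rw [hc.inf_eq_bot, Submodule.mem_bot, sub_eq_zero] at this
    exact this
  have hg_mul : ∀ a b, g (a * b) = g a * g b := by
    intro a b
    refine (hg_unique _ _ ?_ ?_).symm
    · obtain ⟨c, hc⟩ := hg_mem a
      obtain ⟨d, hd⟩ := hg_mem b
      exact ⟨c * d, by rw [hφ, hc, hd]⟩
    · rw [hφ, hφ, hg_sub, hg_sub]
  have hg_id : (LinearMap.id : H →ₗ[k] H) = g := by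
    refine hS.eq_of_comp_pow_eq (fun _ _ => rfl) hg_mul (n + 1) ?_
    ext x
    exact hg_unique _ _ ⟨x, rfl⟩ rfl
  rw [injective_iff_map_eq_zero]
  intro x hx
  have h₀ : (φ ^ (n + 1)) x = 0 := by simp [pow_succ, φ, hx]
  rw [← LinearMap.id_apply (R := k) x, hg_id]
  exact (hg_unique 0 x (zero_mem _) (by rw [h₀, map_zero])).symm

theorem bijective (hS : wb.IsAntipode S) : Function.Bijective S :=
  ⟨hS.injective, LinearMap.injective_iff_surjective.mp hS.injective⟩

end IsAntipode

end WeakBialgebra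

end Antipode

section Translation

variable {k : Type*} [Field k] {H : Type*} [Ring H] [Algebra k H] [FiniteDimensional k H]
variable {wb : WeakBialgebra k H} {A : Type*} [Ring A] [Algebra k A]

namespace ComodAlg

theorem one_mul_coact (ca : ComodAlg wb A) (a : A) : ca.ρ 1 * ca.ρ a = ca.ρ a := by
  rw [← ca.mul, one_mul]

theorem coact_mul_one (ca : ComodAlg wb A) (a : A) : ca.ρ a * ca.ρ 1 = ca.ρ a := by
  rw [← ca.mul, mul_one]

/-- The map `a ⊗ h ↦ a₍₀₎ ⊗ a₍₁₎S(h)`. -/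
def twist (ca : ComodAlg wb A) (S : H →ₗ[k] H) : A ⊗[k] H →ₗ[k] A ⊗[k] H :=
  LinearMap.mul' k (A ⊗[k] H) ∘ₗ TensorProduct.map ca.ρ (TensorProduct.mk k A H 1 ∘ₗ S)

@[simp]
theorem twist_tmul (ca : ComodAlg wb A) (S : H →ₗ[k] H) (a : A) (h : H) :
    ca.twist S (a ⊗ₜ h) = ca.ρ a * (1 ⊗ₜ S h) := by
  simp [twist]

/-- The map `a ⊗ h ↦ a₍₀₎ ⊗ T(h)a₍₁₎`. -/
def untwist (ca : ComodAlg wb A) (T : H →ₗ[k] H) : A ⊗[k] H →ₗ[k] A ⊗[k] H :=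
  LinearMap.mul' k (A ⊗[k] H) ∘ₗ TensorProduct.map (TensorProduct.mk k A H 1 ∘ₗ T) ca.ρ ∘ₗ
    (TensorProduct.comm k A H).toLinearMap

@[simp]
theorem untwist_tmul (ca : ComodAlg wb A) (T : H →ₗ[k] H) (a : A) (h : H) :
    ca.untwist T (a ⊗ₜ h) = (1 ⊗ₜ T h) * ca.ρ a := by
  simp [untwist]

theorem twist_tmul_one_mul (ca : ComodAlg wb A) (S : H →ₗ[k] H) (a : A) (t : A ⊗[k] H) :
    ca.twist S ((a ⊗ₜ 1) * t) = ca.ρ a * ca.twist S t := by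
  induction t using TensorProduct.induction_on with
  | zero => simp
  | add x y hx hy => simp only [mul_add, map_add, hx, hy]
  | tmul b h => simp [ca.mul, mul_assoc]

theorem twist_coact (ca : ComodAlg wb A) {S : H →ₗ[k] H} (hS : wb.IsAntipode S) (a : A) :
    ca.twist S (ca.ρ a) = ca.ρ 1 * (a ⊗ₜ 1) := by
  have h₁ : ∀ (s : A ⊗[k] H) (h : H), s * (1 ⊗ₜ S h) = lTensor A (LinearMap.mul' k H ∘ₗ lTensor H S)
      (TensorProduct.assoc k A H H (s ⊗ₜ h)) := by
    intro s h
    induction s using TensorProduct.induction_on with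
    | zero => simp
    | add x y hx hy => simp only [add_mul, TensorProduct.add_tmul, map_add, hx, hy]
    | tmul b g => simp
  have h₂ : ∀ t : A ⊗[k] H, ca.twist S t = lTensor A (LinearMap.mul' k H ∘ₗ lTensor H S)
      (TensorProduct.assoc k A H H (rTensor H ca.ρ t)) := by
    intro t
    induction t using TensorProduct.induction_on with
    | zero => simp
    | add x y hx hy => simp only [map_add, hx, hy]
    | tmul b h => rw [twist_tmul, h₁, rTensor_tmul]
  have h₃ : (LinearMap.mul' k H ∘ₗ lTensor H S) ∘ₗ wb.comul = wb.projL :=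
    LinearMap.ext hS.antipode_right
  rw [h₂, ca.coassoc, ← LinearMap.comp_apply, ← LinearMap.lTensor_comp, h₃, ca.piL]

theorem untwist_mul_one_tmul (ca : ComodAlg wb A) {S T : H →ₗ[k] H}
    (hT : ∀ x y, T (x * y) = T y * T x) (hTS : ∀ x, T (S x) = x) (s : A ⊗[k] H) (h : H) :
    ca.untwist T (s * (1 ⊗ₜ S h)) = (1 ⊗ₜ h) * ca.untwist T s := by
  induction s using TensorProduct.induction_on with
  | zero => simp
  | add x y hx hy => simp only [add_mul, mul_add, map_add, hx, hy]
  | tmul b g => simp [hT, hTS, ← mul_assoc]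

theorem twist_one_tmul_mul (ca : ComodAlg wb A) {S T : H →ₗ[k] H}
    (hS : ∀ x y, S (x * y) = S y * S x) (hST : ∀ x, S (T x) = x) (h : H) (s : A ⊗[k] H) :
    ca.twist S ((1 ⊗ₜ T h) * s) = ca.twist S s * (1 ⊗ₜ h) := by
  induction s using TensorProduct.induction_on with
  | zero => simp
  | add x y hx hy => simp only [add_mul, mul_add, map_add, hx, hy]
  | tmul b g => simp [hS, hST, mul_assoc]

theorem untwist_coact (ca : ComodAlg wb A) {S T : H →ₗ[k] H} (hS : wb.IsAntipode S)
    (hT : ∀ x y, T (x * y) = T y * T x) (hTS : ∀ x, T (S x) = x) (a : A) :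
    ca.untwist T (ca.ρ a) = (a ⊗ₜ 1) * ca.ρ 1 := by
  have h₁ : ∀ (s : A ⊗[k] H) (h : H), (1 ⊗ₜ T h) * s
      = lTensor A (T ∘ₗ LinearMap.mul' k H ∘ₗ rTensor H S)
          (TensorProduct.assoc k A H H (s ⊗ₜ h)) := by
    intro s h
    induction s using TensorProduct.induction_on with
    | zero => simp
    | add x y hx hy => simp only [mul_add, TensorProduct.add_tmul, map_add, hx, hy]
    | tmul b g => simp [hT, hTS]
  have h₂ : ∀ t : A ⊗[k] H, ca.untwist T t
      = lTensor A (T ∘ₗ LinearMap.mul' k H ∘ₗ rTensor H S)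
          (TensorProduct.assoc k A H H (rTensor H ca.ρ t)) := by
    intro t
    induction t using TensorProduct.induction_on with
    | zero => simp
    | add x y hx hy => simp only [map_add, hx, hy]
    | tmul b h => rw [untwist_tmul, h₁, rTensor_tmul]
  have h₃ : (T ∘ₗ LinearMap.mul' k H ∘ₗ rTensor H S) ∘ₗ wb.comul = wb.projBarR := by
    ext x
    refine (congrArg T (hS.antipode_left x)).trans ?_
    rw [← hS.comp_projBarR, LinearMap.comp_apply, hTS]
  rw [h₂, ca.coassoc, ← LinearMap.comp_apply, ← LinearMap.lTensor_comp, h₃, ca.pibarR]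

theorem untwist_twist (ca : ComodAlg wb A) {S T : H →ₗ[k] H} (hS : wb.IsAntipode S)
    (hT : ∀ x y, T (x * y) = T y * T x) (hTS : ∀ x, T (S x) = x) (w : A ⊗[k] H) :
    ca.untwist T (ca.twist S w) = w * ca.ρ 1 := by
  induction w using TensorProduct.induction_on with
  | zero => simp
  | add x y hx hy => simp only [add_mul, map_add, hx, hy]
  | tmul a h =>
    rw [twist_tmul, ca.untwist_mul_one_tmul hT hTS, ca.untwist_coact hS hT hTS, ← mul_assoc,
      Algebra.TensorProduct.tmul_mul_tmul, one_mul, mul_one]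

theorem twist_untwist (ca : ComodAlg wb A) {S T : H →ₗ[k] H} (hS : wb.IsAntipode S)
    (hST : ∀ x, S (T x) = x) (w : A ⊗[k] H) :
    ca.twist S (ca.untwist T w) = ca.ρ 1 * w := by
  induction w using TensorProduct.induction_on with
  | zero => simp
  | add x y hx hy => simp only [mul_add, map_add, hx, hy]
  | tmul a h =>
    rw [untwist_tmul, ca.twist_one_tmul_mul hS.map_mul hST, ca.twist_coact hS, mul_assoc,
      Algebra.TensorProduct.tmul_mul_tmul, one_mul, mul_one]

theorem one_mul_twist (ca : ComodAlg wb A) (S : H →ₗ[k] H) (w : A ⊗[k] H) :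
    ca.ρ 1 * ca.twist S w = ca.twist S w := by
  induction w using TensorProduct.induction_on with
  | zero => simp
  | add x y hx hy => simp only [mul_add, map_add, hx, hy]
  | tmul a h => rw [twist_tmul, ← mul_assoc, one_mul_coact]

theorem untwist_mul_one (ca : ComodAlg wb A) (T : H →ₗ[k] H) (w : A ⊗[k] H) :
    ca.untwist T w * ca.ρ 1 = ca.untwist T w := by
  induction w using TensorProduct.induction_on with
  | zero => simp
  | add x y hx hy => simp only [add_mul, map_add, hx, hy]
  | tmul a h => rw [untwist_tmul, mul_assoc, coact_mul_one]

end ComodAlg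

end Translation


/-- for a weak Hopf algebra `H` with antipode `S` and a right `H`-comodule algebra
`A` with coinvariants `B`, the maps `β̃(a ⊗ a') = a a'₍₀₎ ⊗ a'₍₁₎`,
`β̃'(a ⊗ a') = a₍₀₎a' ⊗ a₍₁₎` and `η(a ⊗ h) = a₍₀₎ ⊗ a₍₁₎S(h)` satisfy `β̃' = η ∘ β̃`,
`Im β̃' ⊆ ρ(1)(A ⊗ H)`, and the induced map `β : A ⊗_B A → (A ⊗ H)ρ(1)` is injective
(resp. surjective, bijective) iff `β' : A ⊗_B A → ρ(1)(A ⊗ H)` is; in particular `A | B` is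
weak `H`-Galois iff `β'` is bijective onto `ρ(1)(A ⊗ H)`. -/
theorem statement9 {k : Type*} [Field k] {H : Type*} [Ring H] [Algebra k H]
    [FiniteDimensional k H] (wb : WeakBialgebra k H) (S : H →ₗ[k] H) (hS : wb.IsAntipode S)
    {A : Type*} [Ring A] [Algebra k A] (ca : ComodAlg wb A)
    (βt β't : A ⊗[k] A →ₗ[k] A ⊗[k] H)
    (hβt : ∀ a a' : A, βt (a ⊗ₜ[k] a') = (a ⊗ₜ[k] (1 : H)) * ca.ρ a')
    (hβ't : ∀ a a' : A, β't (a ⊗ₜ[k] a') = ca.ρ a * (a' ⊗ₜ[k] (1 : H)))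
    (η : A ⊗[k] H →ₗ[k] A ⊗[k] H)
    (hη : ∀ (a : A) (h : H), η (a ⊗ₜ[k] h) = ca.ρ a * ((1 : A) ⊗ₜ[k] S h)) :
    -- `β̃' = η ∘ β̃`
    β't = η ∘ₗ βt ∧
    -- the image of `β̃'` is contained in `ρ(1)(A ⊗ H)`
    (∀ z : A ⊗[k] A, β't z ∈ Set.range (fun w : A ⊗[k] H => ca.ρ 1 * w)) ∧
    -- correspondence of injectivity/surjectivity/bijectivity for the induced maps
    (∀ β β' : ca.QA →ₗ[k] A ⊗[k] H,
      (∀ x : A ⊗[k] A, β (ca.mkA x) = βt x) →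
      (∀ x : A ⊗[k] A, β' (ca.mkA x) = β't x) →
      ((Function.Injective β ↔ Function.Injective β') ∧
       (Set.range ⇑β = Set.range (fun w : A ⊗[k] H => w * ca.ρ 1)
          ↔ Set.range ⇑β' = Set.range (fun w : A ⊗[k] H => ca.ρ 1 * w)) ∧
       ((Function.Injective β ∧
            Set.range ⇑β = Set.range (fun w : A ⊗[k] H => w * ca.ρ 1))
          ↔ (Function.Injective β' ∧
            Set.range ⇑β' = Set.range (fun w : A ⊗[k] H => ca.ρ 1 * w))))) := by
  obtain rfl : η = ca.twist S := by
    ext a h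
    simpa using hη a h
  let e := LinearEquiv.ofBijective S hS.bijective
  let T : H →ₗ[k] H := e.symm.toLinearMap
  have hTS : ∀ x, T (S x) = x := e.symm_apply_apply
  have hST : ∀ x, S (T x) = x := e.apply_symm_apply
  have hT : ∀ x y, T (x * y) = T y * T x := fun x y =>
    hS.injective (by rw [hS.map_mul, hST, hST, hST])
  have hcomp : β't = ca.twist S ∘ₗ βt := by
    refine TensorProduct.ext' fun a a' => ?_
    rw [LinearMap.comp_apply, hβt, hβ't, ca.twist_tmul_one_mul, ca.twist_coact hS, ← mul_assoc,
      ca.coact_mul_one]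
  refine ⟨hcomp, fun z => ⟨β't z, ?_⟩, fun β β' hβ hβ' => ?_⟩
  · rw [hcomp, LinearMap.comp_apply]
    exact ca.one_mul_twist S _
  have hβt_one : ∀ z, βt z * ca.ρ 1 = βt z := by
    intro z
    induction z using TensorProduct.induction_on with
    | zero => simp
    | add x y hx hy => simp only [add_mul, map_add, hx, hy]
    | tmul a a' => rw [hβt, mul_assoc, ca.coact_mul_one]
  have hsurj : Function.Surjective ca.mkA := ca.rel.mkQ_surjective
  have hβ_one : ∀ q, β q * ca.ρ 1 = β q := by
    intro q
    obtain ⟨z, rfl⟩ := hsurj q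
    rw [hβ, hβt_one]
  have htw : ∀ q, β' q = ca.twist S (β q) := by
    intro q
    obtain ⟨z, rfl⟩ := hsurj q
    rw [hβ, hβ', hcomp, LinearMap.comp_apply]
  have huntw : ∀ q, β q = ca.untwist T (β' q) := by
    intro q
    rw [htw, ca.untwist_twist hS hT hTS, hβ_one]
  have hinj : Function.Injective β ↔ Function.Injective β' :=
    ⟨fun h x y hxy => h (by rw [huntw, hxy, ← huntw]),
      fun h x y hxy => h (by rw [htw, hxy, ← htw])⟩
  have hrange : Set.range ⇑β = Set.range (fun w : A ⊗[k] H => w * ca.ρ 1)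
      ↔ Set.range ⇑β' = Set.range (fun w : A ⊗[k] H => ca.ρ 1 * w) := by
    constructor
    · intro h
      apply Set.Subset.antisymm
      · rintro _ ⟨q, rfl⟩
        exact ⟨β' q, by simp only [htw, ca.one_mul_twist]⟩
      · rintro _ ⟨w, rfl⟩
        obtain ⟨q, hq⟩ : ca.untwist T w ∈ Set.range ⇑β := h ▸ ⟨_, ca.untwist_mul_one T w⟩
        exact ⟨q, by rw [htw, hq, ca.twist_untwist hS hST]⟩
    · intro h
      apply Set.Subset.antisymm
      · rintro _ ⟨q, rfl⟩
        exact ⟨β q, hβ_one q⟩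
      · rintro _ ⟨w, rfl⟩
        obtain ⟨q, hq⟩ : ca.twist S w ∈ Set.range ⇑β' := h ▸ ⟨_, ca.one_mul_twist S w⟩
        exact ⟨q, by rw [huntw, hq, ca.untwist_twist hS hT hTS]⟩
  exact ⟨hinj, hrange, and_congr hinj hrange⟩
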